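/- Let m₋ = ⌊n(log n − log log n)⌋. Asymptotically almost surely the following holds in D(n, m₋): for every set of colours S ⊆ W with |S| = ⌈45εn⌉, the number of vertices v ∈ V whose in-degree counting only those edges of D(n, m₋) with colour in S is at most 43 ε log n (= 43 log log n) is at most n / log log n. -/

import Mathlib

open Filter

/-- The directed edges of the complete digraph on `Fin n`:
ordered pairs `(tail, head)` of distinct vertices. -/
abbrev DEdge (n : ℕ) := {e : Fin n × Fin n // e.1 ≠ e.2}

/-- `ε(n) = log log n / log n`. -/
noncomputable def eps (n : ℕ) : ℝ := Real.log (Real.log n) / Real.log n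

/-- The number of available colours: `⌊(1 + 50 ε) n⌋`. -/
noncomputable def numColours (n : ℕ) : ℕ := ⌊(1 + 50 * eps n) * n⌋₊

/-- The set of colours `W`. -/
abbrev Colour (n : ℕ) := Fin (numColours n)

/-- The sample space of the coloured random digraph process: a uniformly random
permutation of the edges (determining the random ordering `e₁, …, e_N`) together
with a uniformly random colouring of the edges. -/
abbrev SampleSpace (n : ℕ) := Equiv.Perm (DEdge n) × (DEdge n → Colour n)

/-- The (0-indexed) position of edge `e` in the random ordering determined by `ω`. -/
noncomputable def edgePos {n : ℕ} (ω : SampleSpace n) (e : DEdge n) : ℕ :=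
  ((Fintype.equivFin (DEdge n)) (ω.1 e)).val

/-- `e` is one of the first `m` edges of the process, i.e. an edge of `D(n,m)`. -/
def inProcess {n : ℕ} (ω : SampleSpace n) (m : ℕ) (e : DEdge n) : Prop :=
  edgePos ω e < m

/-- The probability of an event under the uniform measure on a finite sample space. -/
noncomputable def prob {Ω : Type*} [Fintype Ω] (p : Ω → Prop) : ℝ :=
  (Nat.card {ω : Ω // p ω} : ℝ) / (Fintype.card Ω : ℝ)

/-- Vertex `v` has in-degree zero in `D(n,m)`. -/
def InDegreeZero {n : ℕ} (ω : SampleSpace n) (m : ℕ) (v : Fin n) : Prop :=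
  ∀ e : DEdge n, inProcess ω m e → e.val.2 ≠ v

/-- The event `Z_m`: at most one vertex of `D(n,m)` has in-degree zero. -/
def ZEvent {n : ℕ} (ω : SampleSpace n) (m : ℕ) : Prop :=
  Set.Subsingleton {v : Fin n | InDegreeZero ω m v}

/-- `A` is the edge set of a spanning arborescence rooted at `u`: the root has no
in-edge, every other vertex has exactly one in-edge, and every vertex is reachable
from the root along edges of `A` (equivalently, for every vertex `v` there is
exactly one directed path from `u` to `v`). -/
def IsSpanningArborescence {n : ℕ} (A : Set (DEdge n)) (u : Fin n) : Prop :=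
  (∀ e ∈ A, (e : DEdge n).val.2 ≠ u) ∧
  (∀ v : Fin n, v ≠ u → ∃! e : DEdge n, e ∈ A ∧ e.val.2 = v) ∧
  (∀ v : Fin n, Relation.ReflTransGen (fun x y => ∃ e ∈ A, (e : DEdge n).val = (x, y)) u v)

/-- The event `A_m`: `D(n,m)` contains a spanning arborescence. -/
def AEvent {n : ℕ} (ω : SampleSpace n) (m : ℕ) : Prop :=
  ∃ (u : Fin n) (A : Set (DEdge n)), (∀ e ∈ A, inProcess ω m e) ∧ IsSpanningArborescence A u

/-- The event `R_m`: `D(n,m)` contains a rainbow spanning arborescence. -/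
def REvent {n : ℕ} (ω : SampleSpace n) (m : ℕ) : Prop :=
  ∃ (u : Fin n) (A : Set (DEdge n)), (∀ e ∈ A, inProcess ω m e) ∧
    IsSpanningArborescence A u ∧ Set.InjOn ω.2 A

/-- The hitting time `min {m : P m}`, with the convention `min ∅ = N = n(n-1)`. -/
noncomputable def hitTime (n : ℕ) (P : ℕ → Prop) : ℕ :=
  sInf ({m | P m} ∪ {n * (n - 1)})

/-- The in-degree of `v` in `D(n,m)` counting only edges whose colour lies in `S`. -/
noncomputable def inDegreeInColours {n : ℕ} (ω : SampleSpace n) (m : ℕ)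
    (S : Set (Colour n)) (v : Fin n) : ℕ :=
  Nat.card {e : DEdge n // inProcess ω m e ∧ e.val.2 = v ∧ ω.2 e ∈ S}

section PermutationMoments

open Finset

variable {α κ : Type*} [Fintype α] [DecidableEq α] [Fintype κ] [DecidableEq κ]

theorem card_perm_mapsTo_insert_eq (B J : Finset α) {x y : α} (hx : x ∉ J) (hy : y ∉ J) :
    #{σ : Equiv.Perm α | ∀ i ∈ insert x J, σ i ∈ B} =
      #{σ : Equiv.Perm α | ∀ i ∈ insert y J, σ i ∈ B} := by
  refine card_equiv (Equiv.mulRight (Equiv.swap x y)) fun σ => ?_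
  have hJ : ∀ i ∈ J, Equiv.swap x y i = i := fun i hi =>
    Equiv.swap_apply_of_ne_of_ne (by rintro rfl; exact hx hi) (by rintro rfl; exact hy hi)
  simp only [mem_filter, mem_univ, true_and, forall_mem_insert, Equiv.coe_mulRight,
    Equiv.Perm.mul_apply, Equiv.swap_apply_right]
  refine and_congr_right fun _ => forall₂_congr fun i hi => ?_
  rw [hJ i hi]

theorem card_compl_mul_card_perm_mapsTo_insert (B J : Finset α) {x : α} (hx : x ∉ J) :
    ((Fintype.card α : ℝ) - #J) * #{σ : Equiv.Perm α | ∀ i ∈ insert x J, σ i ∈ B} =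
      ((#B : ℝ) - #J) * #{σ : Equiv.Perm α | ∀ i ∈ J, σ i ∈ B} := by
  have hl : ∑ y ∈ Jᶜ, #{σ : Equiv.Perm α | ∀ i ∈ insert y J, σ i ∈ B} =
      #Jᶜ * #{σ : Equiv.Perm α | ∀ i ∈ insert x J, σ i ∈ B} := by
    rw [sum_congr rfl fun y hy =>
      card_perm_mapsTo_insert_eq B J (mem_compl.1 hy) hx, sum_const, smul_eq_mul]
  have hr : ∑ y ∈ Jᶜ, #{σ : Equiv.Perm α | ∀ i ∈ insert y J, σ i ∈ B} =
      ∑ σ : Equiv.Perm α with ∀ i ∈ J, σ i ∈ B, #{y ∈ Jᶜ | σ y ∈ B} := by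
    have := sum_card_bipartiteAbove_eq_sum_card_bipartiteBelow
      (s := Jᶜ) (t := ({σ : Equiv.Perm α | ∀ i ∈ J, σ i ∈ B} : Finset _))
      (fun y (σ : Equiv.Perm α) => σ y ∈ B)
    simp only [bipartiteBelow] at this
    rw [← this]
    refine sum_congr rfl fun y _ => congrArg card ?_
    ext σ
    simp [bipartiteAbove, and_comm]
  have hc : (#Jᶜ : ℝ) = (Fintype.card α : ℝ) - #J := by
    rw [card_compl, Nat.cast_sub (card_le_univ J)]
  have hB : ∀ σ ∈ ({σ : Equiv.Perm α | ∀ i ∈ J, σ i ∈ B} : Finset _),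
      (#{y ∈ Jᶜ | σ y ∈ B} : ℝ) = (#B : ℝ) - #J := by
    intro σ hσ
    have hσ' : ∀ i ∈ J, σ i ∈ B := by simpa using hσ
    have h1 : #{y : α | σ y ∈ B} = #B :=
      card_equiv σ fun i => by simp
    have h2 : #{y ∈ Jᶜ | σ y ∈ B} + #J = #{y : α | σ y ∈ B} := by
      rw [← card_union_of_disjoint]
      · congr 1
        ext y
        by_cases hy : y ∈ J <;> simp [hy, hσ']
      · exact disjoint_left.2 fun y hy => by simpa using (mem_compl.1 (mem_filter.1 hy).1)
    rw [eq_sub_iff_add_eq, ← h1, ← h2]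
    push_cast
    ring
  have h := congrArg (Nat.cast : ℕ → ℝ) (hl.symm.trans hr)
  push_cast at h
  rw [hc, sum_congr rfl hB, sum_const, nsmul_eq_mul] at h
  rw [h, mul_comm]

/-- For a uniform permutation the events `σ i ∈ B` are negatively correlated. -/
theorem card_perm_mapsTo_mul_pow_le (B J : Finset α) :
    (#{σ : Equiv.Perm α | ∀ i ∈ J, σ i ∈ B} : ℝ) * (Fintype.card α : ℝ) ^ #J ≤
      Fintype.card (Equiv.Perm α) * (#B : ℝ) ^ #J := by
  induction J using Finset.induction_on with
  | empty => simp
  | insert x J hx ih =>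
    have h := card_compl_mul_card_perm_mapsTo_insert B J hx
    have hJ : 0 < (Fintype.card α : ℝ) - #J := by
      rw [sub_pos, Nat.cast_lt]
      exact card_lt_univ_of_notMem hx
    have hB : (#B : ℝ) ≤ Fintype.card α := by exact_mod_cast card_le_univ B
    rw [card_insert_of_notMem hx, pow_succ, pow_succ]
    generalize (#{σ : Equiv.Perm α | ∀ i ∈ insert x J, σ i ∈ B} : ℝ) = P at *
    generalize hQ : (#{σ : Equiv.Perm α | ∀ i ∈ J, σ i ∈ B} : ℝ) = Q at *
    have hQ0 : 0 ≤ Q := hQ ▸ Nat.cast_nonneg _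
    refine le_of_mul_le_mul_left ?_ hJ
    have h3 : (Fintype.card α : ℝ) * ((#B : ℝ) - #J) ≤ #B * ((Fintype.card α : ℝ) - #J) := by
      nlinarith [(Nat.cast_nonneg #J : (0 : ℝ) ≤ #J)]
    calc ((Fintype.card α : ℝ) - #J) * (P * ((Fintype.card α : ℝ) ^ #J * Fintype.card α))
        = (Fintype.card α * ((#B : ℝ) - #J)) * (Q * (Fintype.card α : ℝ) ^ #J) := by
          linear_combination ((Fintype.card α : ℝ) ^ #J * Fintype.card α) * h
      _ ≤ (#B * ((Fintype.card α : ℝ) - #J)) * (Q * (Fintype.card α : ℝ) ^ #J) := by gcongr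
      _ ≤ (#B * ((Fintype.card α : ℝ) - #J)) *
            (Fintype.card (Equiv.Perm α) * (#B : ℝ) ^ #J) := by
          gcongr
      _ = _ := by ring

theorem card_perm_mapsTo_le (B J : Finset α) :
    (#{σ : Equiv.Perm α | ∀ i ∈ J, σ i ∈ B} : ℝ) ≤
      Fintype.card (Equiv.Perm α) * ((#B : ℝ) / Fintype.card α) ^ #J := by
  rcases J.eq_empty_or_nonempty with rfl | ⟨x, -⟩
  · simp
  · have : 0 < (Fintype.card α : ℝ) := by exact_mod_cast Fintype.card_pos_iff.2 ⟨x⟩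
    rw [div_pow, ← mul_div_assoc, le_div_iff₀ (by positivity)]
    exact card_perm_mapsTo_mul_pow_le B J

theorem sum_perm_pow_card_le (A M : Finset α) {z : ℝ} (hz0 : 0 ≤ z) (hz1 : z ≤ 1) :
    ∑ σ : Equiv.Perm α, z ^ #{i ∈ A | σ i ∈ M} ≤
      Fintype.card (Equiv.Perm α) *
        Real.exp (-((1 - z) * (#M / Fintype.card α) * #A)) := by
  have hexp : ∀ σ : Equiv.Perm α, z ^ #{i ∈ A | σ i ∈ M} =
      ∑ J ∈ A.powerset, (1 - z) ^ #J * z ^ (#A - #J) *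
        if ∀ i ∈ J, σ i ∈ Mᶜ then 1 else 0 := by
    intro σ
    have h1 : z ^ #{i ∈ A | σ i ∈ M} = ∏ i ∈ A, ((if σ i ∈ Mᶜ then 1 - z else 0) + z) := by
      rw [← prod_const, prod_filter]
      refine prod_congr rfl fun i _ => ?_
      by_cases h : σ i ∈ M <;> simp [h]
    rw [h1, prod_add]
    refine sum_congr rfl fun J hJ => ?_
    rw [prod_const, card_sdiff_of_subset (mem_powerset.1 hJ), prod_ite_zero, prod_const]
    split_ifs <;> ring
  rcases A.eq_empty_or_nonempty with rfl | ⟨x, -⟩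
  · simp
  have hN : 0 < (Fintype.card α : ℝ) := by exact_mod_cast Fintype.card_pos_iff.2 ⟨x⟩
  have hM : (#Mᶜ : ℝ) / Fintype.card α = 1 - #M / Fintype.card α := by
    rw [card_compl, Nat.cast_sub (card_le_univ M), sub_div, div_self hN.ne']
  have hM1 : (#M : ℝ) / Fintype.card α ≤ 1 := by
    rw [div_le_one hN]; exact_mod_cast card_le_univ M
  calc ∑ σ : Equiv.Perm α, z ^ #{i ∈ A | σ i ∈ M}
      = ∑ J ∈ A.powerset, (1 - z) ^ #J * z ^ (#A - #J) *
          #{σ : Equiv.Perm α | ∀ i ∈ J, σ i ∈ Mᶜ} := by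
        rw [sum_congr rfl fun σ _ => hexp σ, sum_comm]
        refine sum_congr rfl fun J _ => ?_
        rw [← mul_sum, sum_boole]
    _ ≤ ∑ J ∈ A.powerset, (1 - z) ^ #J * z ^ (#A - #J) *
          (Fintype.card (Equiv.Perm α) * ((#Mᶜ : ℝ) / Fintype.card α) ^ #J) := by
        refine sum_le_sum fun J _ => ?_
        have : 0 ≤ 1 - z := by linarith
        gcongr
        exact card_perm_mapsTo_le _ _
    _ = Fintype.card (Equiv.Perm α) * (((1 - z) * (1 - #M / Fintype.card α)) + z) ^ #A := by
        rw [← sum_pow_mul_eq_add_pow, mul_sum, hM]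
        refine sum_congr rfl fun J _ => ?_
        rw [mul_pow]
        ring
    _ ≤ _ := by
        have h0 : 0 ≤ (1 - z) * (1 - (#M : ℝ) / Fintype.card α) :=
          mul_nonneg (by linarith) (by linarith)
        have h1 : (1 - z) * (1 - (#M : ℝ) / Fintype.card α) + z ≤
            Real.exp (-((1 - z) * (#M / Fintype.card α))) := by
          have := Real.add_one_le_exp (-((1 - z) * ((#M : ℝ) / Fintype.card α)))
          linarith
        calc _ ≤ (Fintype.card (Equiv.Perm α) : ℝ) *
              Real.exp (-((1 - z) * (#M / Fintype.card α))) ^ #A := by gcongr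
          _ = _ := by rw [← Real.exp_nat_mul]; congr 2; ring

theorem sum_colouring_pow_card [Nonempty κ] (A : Finset α) (S : Finset κ) (s : ℝ) :
    ∑ c : α → κ, s ^ #{i ∈ A | c i ∈ S} =
      Fintype.card (α → κ) * (1 - (1 - s) * (#S / Fintype.card κ)) ^ #A := by
  have hκ : (Fintype.card κ : ℝ) ≠ 0 := by exact_mod_cast Fintype.card_ne_zero
  have h1 : ∀ c : α → κ, s ^ #{i ∈ A | c i ∈ S} =
      ∏ i, if i ∈ A then (if c i ∈ S then s else 1) else 1 := by
    intro c
    rw [← prod_filter, filter_mem_eq_inter, univ_inter, ← prod_filter, prod_const]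
  have h2 : ∑ k : κ, (if k ∈ S then s else 1) =
      Fintype.card κ * (1 - (1 - s) * (#S / Fintype.card κ)) := by
    have : ∀ k : κ, (if k ∈ S then s else 1) = 1 - (1 - s) * (if k ∈ S then 1 else 0) := by
      intro k; split_ifs <;> ring
    rw [sum_congr rfl fun k _ => this k, sum_sub_distrib, ← mul_sum, sum_boole,
      filter_mem_eq_inter, univ_inter]
    simp only [sum_const, card_univ, nsmul_eq_mul, mul_one]
    field_simp
  rw [sum_congr rfl fun c _ => h1 c]
  have h3 := (prod_univ_sum (fun _ : α => (univ : Finset κ))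
    fun i k => if i ∈ A then (if k ∈ S then s else (1 : ℝ)) else 1).symm
  rw [Fintype.piFinset_univ] at h3
  rw [h3]
  have h4 : ∀ i : α, ∑ k : κ, (if i ∈ A then (if k ∈ S then s else (1 : ℝ)) else 1) =
      Fintype.card κ * if i ∈ A then (1 - (1 - s) * (#S / Fintype.card κ)) else 1 := by
    intro i
    split_ifs
    · exact h2
    · simp
  rw [prod_congr rfl fun i _ => h4 i, prod_mul_distrib, ← prod_filter, filter_mem_eq_inter,
    univ_inter, prod_const, prod_const, Fintype.card_fun, card_univ]
  push_cast
  rfl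

theorem sum_perm_colouring_pow_card_le [Nonempty κ] (A M : Finset α) (S : Finset κ) {s : ℝ}
    (hs0 : 0 ≤ s) (hs1 : s ≤ 1) :
    ∑ ω : Equiv.Perm α × (α → κ), s ^ #{i ∈ A | ω.1 i ∈ M ∧ ω.2 i ∈ S} ≤
      Fintype.card (Equiv.Perm α × (α → κ)) *
        Real.exp (-((1 - s) * (#S / Fintype.card κ) * (#M / Fintype.card α) * #A)) := by
  have hκ : 0 < (Fintype.card κ : ℝ) := by exact_mod_cast Fintype.card_pos
  have hq0 : 0 ≤ (#S : ℝ) / Fintype.card κ := by positivity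
  have hq1 : (#S : ℝ) / Fintype.card κ ≤ 1 := by
    rw [div_le_one hκ]; exact_mod_cast card_le_univ S
  set q : ℝ := (#S : ℝ) / Fintype.card κ
  have h := sum_perm_pow_card_le A M (z := 1 - (1 - s) * q) (by nlinarith) (by nlinarith)
  rw [Fintype.sum_prod_type]
  have h1 : ∀ σ : Equiv.Perm α, ∑ c : α → κ, s ^ #{i ∈ A | σ i ∈ M ∧ c i ∈ S} =
      Fintype.card (α → κ) * (1 - (1 - s) * q) ^ #{i ∈ A | σ i ∈ M} := by
    intro σ
    rw [← sum_colouring_pow_card]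
    simp only [filter_filter]
  simp only [h1]
  rw [← mul_sum, Fintype.card_prod]
  refine (mul_le_mul_of_nonneg_left h (Nat.cast_nonneg _)).trans (le_of_eq ?_)
  rw [sub_sub_cancel]
  push_cast
  ring

theorem card_few_coloured_le [Nonempty κ] (A M : Finset α) (S : Finset κ) (x : ℝ) :
    (#{ω : Equiv.Perm α × (α → κ) |
        (#{i ∈ A | ω.1 i ∈ M ∧ ω.2 i ∈ S} : ℝ) ≤ x} : ℝ) ≤
      Fintype.card (Equiv.Perm α × (α → κ)) *
        Real.exp (x / 44 - (#S / Fintype.card κ) * (#M / Fintype.card α) * #A / 45) := by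
  have hs : Real.exp (-(1 / 44)) ≤ 44 / 45 := by
    rw [Real.exp_neg, inv_le_comm₀ (Real.exp_pos _) (by norm_num)]
    have := Real.add_one_le_exp (1 / 44 : ℝ)
    norm_num at this ⊢
    linarith
  have h := sum_perm_colouring_pow_card_le A M S (s := 44 / 45) (by norm_num) (by norm_num)
  rw [card_filter]
  push_cast
  calc _ ≤ ∑ ω : Equiv.Perm α × (α → κ),
        Real.exp (x / 44) * (44 / 45 : ℝ) ^ #{i ∈ A | ω.1 i ∈ M ∧ ω.2 i ∈ S} := by
        refine sum_le_sum fun ω _ => ?_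
        split_ifs with hx
        · calc (1 : ℝ) ≤ Real.exp (x / 44) *
                Real.exp (-(1 / 44)) ^ #{i ∈ A | ω.1 i ∈ M ∧ ω.2 i ∈ S} := by
                rw [← Real.exp_nat_mul, ← Real.exp_add]
                exact Real.one_le_exp (by linarith)
            _ ≤ _ := by gcongr
        · positivity
    _ ≤ Real.exp (x / 44) * (Fintype.card (Equiv.Perm α × (α → κ)) *
          Real.exp (-((1 - 44 / 45) * (#S / Fintype.card κ) * (#M / Fintype.card α) * #A))) := by
        rw [← mul_sum]
        exact mul_le_mul_of_nonneg_left h (Real.exp_pos _).le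
    _ = _ := by
        rw [mul_left_comm, ← Real.exp_add]
        congr 2
        ring

end PermutationMoments

theorem choose_le_exp (n k : ℕ) : (n.choose k : ℝ) ≤ Real.exp (n / 1000 + 27 * k) := by
  have h1 : (n.choose k : ℝ) * (1 / 1000) ^ k ≤ (1 / 1000 + 1) ^ n := by
    rw [add_pow]
    rcases le_or_gt k n with hk | hk
    · refine le_trans (le_of_eq ?_) (Finset.single_le_sum
        (f := fun i => (1 / 1000 : ℝ) ^ i * 1 ^ (n - i) * (n.choose i))
        (fun i _ => by positivity) (Finset.mem_range.2 (Nat.lt_succ_of_le hk)))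
      simp only [one_pow]
      ring
    · rw [Nat.choose_eq_zero_of_lt hk]
      simp only [Nat.cast_zero, zero_mul]
      exact Finset.sum_nonneg fun i _ => by positivity
  have h2 : (1 / 1000 + 1 : ℝ) ^ n ≤ Real.exp (n / 1000) := by
    calc (1 / 1000 + 1 : ℝ) ^ n ≤ Real.exp (1 / 1000) ^ n := by
          gcongr; exact Real.add_one_le_exp _
      _ = _ := by rw [← Real.exp_nat_mul]; congr 1; ring
  have h3 : (1000 : ℝ) ^ k ≤ Real.exp (27 * k) := by
    have h9 : (1000 : ℝ) ≤ Real.exp 27 := by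
      calc (1000 : ℝ) = (9 + 1) ^ 3 := by norm_num
        _ ≤ Real.exp 9 ^ 3 := by gcongr; exact Real.add_one_le_exp _
        _ = _ := by rw [← Real.exp_nat_mul]; norm_num
    calc (1000 : ℝ) ^ k ≤ Real.exp 27 ^ k := by gcongr
      _ = _ := by rw [← Real.exp_nat_mul]; congr 1; ring
  rw [Real.exp_add]
  calc (n.choose k : ℝ) = n.choose k * (1 / 1000) ^ k * 1000 ^ k := by
        rw [mul_assoc, ← mul_pow]; norm_num
    _ ≤ _ := by gcongr; exact h1.trans h2

section ColouredDigraph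

open Finset

variable {n : ℕ}

theorem card_filter_head_eq (v : Fin n) : #{e : DEdge n | e.val.2 = v} = n - 1 := by
  have h : #{e : DEdge n | e.val.2 = v} = #(univ.erase v) := by
    refine card_bij' (fun e _ => e.val.1)
      (fun u hu => ⟨(u, v), (mem_erase.1 hu).1⟩) ?_ ?_ ?_ ?_
    · intro e he
      have := e.2
      simp only [mem_filter, mem_univ, true_and] at he
      simpa [← he] using this
    · simp
    · rintro ⟨⟨a, b⟩, hab⟩ he
      simp only [mem_filter, mem_univ, true_and] at he
      simp [← he]
    · simp
  rw [h, card_erase_of_mem (mem_univ v), card_univ, Fintype.card_fin]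

theorem card_filter_head_mem (T : Finset (Fin n)) :
    #{e : DEdge n | e.val.2 ∈ T} = #T * (n - 1) := by
  rw [card_eq_sum_card_fiberwise (f := fun e : DEdge n => e.val.2) (t := T)
    (fun e he => by simpa using he)]
  refine (sum_congr rfl fun v hv => ?_).trans (sum_const (n - 1))
  rw [← card_filter_head_eq v, filter_filter]
  refine congrArg card (filter_congr fun e _ => ?_)
  exact ⟨fun h => h.2, fun h => ⟨h ▸ hv, h⟩⟩

theorem card_DEdge (n : ℕ) : Fintype.card (DEdge n) = n * (n - 1) := by
  have h := card_filter_head_mem (univ : Finset (Fin n))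
  simpa only [mem_univ, filter_true, card_univ, Fintype.card_fin] using h

theorem card_filter_equivFin_lt {m : ℕ} (hm : m ≤ Fintype.card (DEdge n)) :
    #{e : DEdge n | (Fintype.equivFin (DEdge n) e).val < m} = m := by
  rw [card_equiv (t := {i : Fin (Fintype.card (DEdge n)) | i.val < m})
    (Fintype.equivFin (DEdge n)) fun e => by simp]
  rw [Fin.card_filter_val_lt, min_eq_right hm]

theorem sum_inDegreeInColours (ω : SampleSpace n) (m : ℕ) (S : Finset (Colour n))
    (T : Finset (Fin n)) :
    ∑ v ∈ T, inDegreeInColours ω m S v =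
      #{e ∈ ({e : DEdge n | e.val.2 ∈ T} : Finset _) |
        ω.1 e ∈ ({e : DEdge n | (Fintype.equivFin (DEdge n) e).val < m} : Finset _) ∧
          ω.2 e ∈ S} := by
  rw [card_eq_sum_card_fiberwise (f := fun e : DEdge n => e.val.2) (t := T)
    (fun e he => by
      simp only [coe_filter, Set.mem_ofPred_eq, mem_filter, mem_univ, true_and] at he
      exact he.1)]
  refine sum_congr rfl fun v hv => ?_
  classical
  rw [inDegreeInColours, Nat.card_eq_fintype_card, Fintype.card_subtype]
  refine congrArg card ?_
  ext e
  simp only [mem_filter, mem_univ, true_and, inProcess, edgePos, mem_coe]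
  constructor
  · rintro ⟨h1, rfl, h3⟩
    exact ⟨⟨hv, h1, h3⟩, rfl⟩
  · rintro ⟨⟨-, h1, h3⟩, rfl⟩
    exact ⟨h1, rfl, h3⟩

theorem prob_exists_small_coloured_indegree_le [Nonempty (Colour n)] (hn : 2 ≤ n)
    {r k m : ℕ} (hm : m ≤ n * (n - 1)) (d : ℝ) :
    prob (fun ω : SampleSpace n => ∃ S : Finset (Colour n), #S = r ∧
        ∃ T : Finset (Fin n), #T = k ∧ ∀ v ∈ T, (inDegreeInColours ω m S v : ℝ) ≤ d) ≤
      (numColours n).choose r * n.choose k *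
        Real.exp (d * k / 44 - (r / numColours n) * m * k / n / 45) := by
  classical
  rw [prob, Nat.card_eq_fintype_card, Fintype.card_subtype]
  have hΩ : 0 < (Fintype.card (SampleSpace n) : ℝ) := by exact_mod_cast Fintype.card_pos
  rw [div_le_iff₀ hΩ]
  set M : Finset (DEdge n) := {e : DEdge n | (Fintype.equivFin (DEdge n) e).val < m} with hM
  have hMc : #M = m := card_filter_equivFin_lt (by rwa [card_DEdge])
  let bad : Finset (Colour n) → Finset (Fin n) → Finset (SampleSpace n) := fun S T =>
    {ω | (#{e ∈ ({e : DEdge n | e.val.2 ∈ T} : Finset _) | ω.1 e ∈ M ∧ ω.2 e ∈ S} : ℝ) ≤ d * k}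
  have hbad : ∀ S ∈ powersetCard r (univ : Finset (Colour n)),
      ∀ T ∈ powersetCard k (univ : Finset (Fin n)), (#(bad S T) : ℝ) ≤
        Fintype.card (SampleSpace n) *
          Real.exp (d * k / 44 - (r / numColours n) * m * k / n / 45) := by
    intro S hS T hT
    have h := card_few_coloured_le ({e : DEdge n | e.val.2 ∈ T} : Finset _) M S (d * k)
    rw [card_filter_head_mem, hMc, (mem_powersetCard.1 hS).2, (mem_powersetCard.1 hT).2,
      card_DEdge, Fintype.card_fin] at h
    refine h.trans (le_of_eq ?_)
    have h1 : ((n - 1 : ℕ) : ℝ) ≠ 0 := by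
      rw [Nat.cast_ne_zero]; omega
    have h2 : (n : ℝ) ≠ 0 := by
      rw [Nat.cast_ne_zero]; omega
    congr 3
    push_cast
    field_simp
  have hsub : ({ω : SampleSpace n | ∃ S : Finset (Colour n), #S = r ∧
        ∃ T : Finset (Fin n), #T = k ∧
          ∀ v ∈ T, (inDegreeInColours ω m S v : ℝ) ≤ d} : Finset _) ⊆
      (powersetCard r univ).biUnion fun S => (powersetCard k univ).biUnion fun T => bad S T := by
    intro ω hω
    simp only [mem_filter, mem_univ, true_and] at hω
    obtain ⟨S, hS, T, hT, h⟩ := hω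
    refine mem_biUnion.2 ⟨S, mem_powersetCard.2 ⟨subset_univ _, hS⟩,
      mem_biUnion.2 ⟨T, mem_powersetCard.2 ⟨subset_univ _, hT⟩, ?_⟩⟩
    simp only [bad, mem_filter, mem_univ, true_and]
    have h1 := sum_inDegreeInColours ω m S T
    simp only [mem_filter, mem_univ, true_and, hM] at h1 ⊢
    rw [← h1]
    push_cast
    calc _ ≤ ∑ v ∈ T, d := sum_le_sum h
      _ = _ := by rw [sum_const, hT, nsmul_eq_mul, mul_comm]
  calc _ ≤ (#((powersetCard r univ).biUnion fun S =>
          (powersetCard k univ).biUnion fun T => bad S T) : ℝ) := by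
        exact_mod_cast card_le_card hsub
    _ ≤ ∑ S ∈ powersetCard r univ, ∑ T ∈ powersetCard k univ, (#(bad S T) : ℝ) := by
        exact_mod_cast card_biUnion_le.trans (sum_le_sum fun S _ => card_biUnion_le)
    _ ≤ ∑ S ∈ powersetCard r (univ : Finset (Colour n)),
          ∑ T ∈ powersetCard k (univ : Finset (Fin n)),
          (Fintype.card (SampleSpace n) *
            Real.exp (d * k / 44 - (r / numColours n) * m * k / n / 45)) :=
        sum_le_sum fun S hS => sum_le_sum fun T hT => hbad S hS T hT
    _ = _ := by
        simp only [sum_const, card_powersetCard, card_univ, Fintype.card_fin, nsmul_eq_mul]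
        ring

theorem prob_eq_one_sub {Ω : Type*} [Fintype Ω] [Nonempty Ω] (p : Ω → Prop) :
    prob p = 1 - prob fun ω => ¬ p ω := by
  classical
  have hΩ : (Fintype.card Ω : ℝ) ≠ 0 := by exact_mod_cast Fintype.card_ne_zero
  simp only [prob, Nat.card_eq_fintype_card]
  rw [Fintype.card_subtype_compl, Nat.cast_sub (Fintype.card_subtype_le p)]
  field_simp
  ring

theorem prob_mono {Ω : Type*} [Fintype Ω] {p q : Ω → Prop} (h : ∀ ω, p ω → q ω) :
    prob p ≤ prob q := by
  unfold prob
  gcongr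
  exact Nat.card_mono (Set.toFinite _) h

theorem exists_card_eq_of_lt_ncard {p : Fin n → Prop} {y : ℝ} (hy : 0 ≤ y)
    (h : y < {v | p v}.ncard) :
    ∃ T : Finset (Fin n), #T = ⌊y⌋₊ + 1 ∧ ∀ v ∈ T, p v := by
  classical
  rw [Set.ncard_eq_toFinset_card'] at h
  obtain ⟨T, hT, hc⟩ := exists_subset_card_eq
    (Nat.succ_le_of_lt ((Nat.floor_lt hy).2 h))
  exact ⟨T, hc, fun v hv => by simpa using hT hv⟩

theorem one_sub_le_prob_few_small_coloured_indegree [Nonempty (Colour n)] (hn : 2 ≤ n)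
    {r m : ℕ} (hm : m ≤ n * (n - 1)) (d : ℝ) {y : ℝ} (hy : 0 ≤ y) :
    1 - (numColours n).choose r * n.choose (⌊y⌋₊ + 1) *
        Real.exp (d * (⌊y⌋₊ + 1 : ℕ) / 44 -
          (r / numColours n) * m * (⌊y⌋₊ + 1 : ℕ) / n / 45) ≤
      prob (fun ω : SampleSpace n => ∀ S : Set (Colour n), S.ncard = r →
        ({v : Fin n | (inDegreeInColours ω m S v : ℝ) ≤ d}.ncard : ℝ) ≤ y) := by
  classical
  rw [prob_eq_one_sub (Ω := SampleSpace n)]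
  refine sub_le_sub_left ((prob_mono fun ω h => ?_).trans
    (prob_exists_small_coloured_indegree_le hn hm d)) 1
  push Not at h
  obtain ⟨S, hS, h⟩ := h
  refine ⟨S.toFinset, by rw [← hS, Set.ncard_eq_toFinset_card'], ?_⟩
  rw [Set.coe_toFinset]
  exact exists_card_eq_of_lt_ncard hy h

end ColouredDigraph

theorem numColours_le {n : ℕ} (hε0 : 0 ≤ eps n) (hε : eps n ≤ 1 / 10 ^ 6) :
    (numColours n : ℝ) ≤ (1 + 50 / 10 ^ 6) * n := by
  refine (Nat.floor_le (by positivity)).trans ?_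
  gcongr
  linarith

theorem le_numColours {n : ℕ} (hε0 : 0 ≤ eps n) : n ≤ numColours n := by
  refine Nat.le_floor ?_
  nlinarith [(Nat.cast_nonneg n : (0 : ℝ) ≤ n)]

theorem le_colour_fraction_mul_edges {n : ℕ} (hn : 1 ≤ n) (hl : 1 ≤ Real.log (Real.log n))
    (hL : 0 < Real.log n) (hε : eps n ≤ 1 / 10 ^ 6) :
    44.5 * Real.log (Real.log n) * n ≤ (⌈45 * eps n * n⌉₊ : ℝ) / numColours n *
      (⌊(n : ℝ) * (Real.log n - Real.log (Real.log n))⌋₊ : ℝ) := by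
  have hεL : eps n * Real.log n = Real.log (Real.log n) := div_mul_cancel₀ _ hL.ne'
  have hε0 : 0 ≤ eps n := div_nonneg (by linarith) hL.le
  have hn0 : (1 : ℝ) ≤ n := by exact_mod_cast hn
  have hw0 : (0 : ℝ) < numColours n := by exact_mod_cast hn.trans (le_numColours hε0)
  have hw := numColours_le hε0 hε
  have hr : 45 * eps n * n ≤ (⌈45 * eps n * n⌉₊ : ℝ) := Nat.le_ceil _
  have hm := (Nat.lt_floor_add_one ((n : ℝ) * (Real.log n - Real.log (Real.log n)))).le
  have hm0 : (0 : ℝ) ≤ ⌊(n : ℝ) * (Real.log n - Real.log (Real.log n))⌋₊ := Nat.cast_nonneg _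
  generalize (⌊(n : ℝ) * (Real.log n - Real.log (Real.log n))⌋₊ : ℝ) = m at *
  generalize (⌈45 * eps n * n⌉₊ : ℝ) = r at *
  have hq : 44.99 * eps n ≤ r / numColours n := by
    rw [le_div_iff₀ hw0]
    calc 44.99 * eps n * numColours n ≤ 44.99 * eps n * ((1 + 50 / 10 ^ 6) * n) := by gcongr
      _ ≤ 45 * eps n * n := by
        have : 0 ≤ eps n * n := by positivity
        nlinarith
      _ ≤ r := hr
  generalize eps n = ε at *
  generalize Real.log (Real.log n) = l at *
  have h1 : 0.999 * (l * n) ≤ ε * m := by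
    have h2 : ε * (n * (Real.log n - l)) ≤ ε * (m + 1) := by gcongr
    have h3 : ε * (n * l) ≤ 1 / 10 ^ 6 * (n * l) := by gcongr
    have h4 : 1 ≤ n * l := by nlinarith
    have h5 : ε * (n * (Real.log n - l)) = n * l - ε * (n * l) := by rw [← hεL]; ring
    linarith
  calc 44.5 * l * n ≤ 44.99 * (ε * m) := by
        have : 0 ≤ l * n := by positivity
        nlinarith
    _ = 44.99 * ε * m := by ring
    _ ≤ _ := by gcongr

theorem choose_mul_choose_mul_exp_le {n : ℕ} (hn : 10 ^ 6 ≤ n)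
    (hl : 10 ^ 6 ≤ Real.log (Real.log n)) (hL : 0 < Real.log n) (hε : eps n ≤ 1 / 10 ^ 6) :
    ((numColours n).choose ⌈45 * eps n * n⌉₊ : ℝ) *
        n.choose (⌊(n : ℝ) / Real.log (Real.log n)⌋₊ + 1) *
        Real.exp (43 * eps n * Real.log n * (⌊(n : ℝ) / Real.log (Real.log n)⌋₊ + 1 : ℕ) / 44 -
          ((⌈45 * eps n * n⌉₊ : ℝ) / numColours n) *
            (⌊(n : ℝ) * (Real.log n - Real.log (Real.log n))⌋₊ : ℝ) *
            (⌊(n : ℝ) / Real.log (Real.log n)⌋₊ + 1 : ℕ) / n / 45) ≤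
      Real.exp (-(n / 1000)) := by
  have hqm := le_colour_fraction_mul_edges (le_trans (by norm_num) hn)
    (le_trans (by norm_num) hl) hL hε
  have hεL : eps n * Real.log n = Real.log (Real.log n) := div_mul_cancel₀ _ hL.ne'
  have hl0 : 0 < Real.log (Real.log n) := lt_of_lt_of_le (by norm_num) hl
  have hε0 : 0 ≤ eps n := div_nonneg hl0.le hL.le
  have hn' : (10 : ℝ) ^ 6 ≤ n := by exact_mod_cast hn
  have hn0 : (0 : ℝ) < n := lt_of_lt_of_le (by norm_num) hn'
  have hw := numColours_le hε0 hε
  have hr : (⌈45 * eps n * n⌉₊ : ℝ) ≤ 46 / 10 ^ 6 * n := by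
    have h1 := (Nat.ceil_lt_add_one (by positivity : 0 ≤ 45 * eps n * n)).le
    have h2 : 45 * eps n * n ≤ 45 * (1 / 10 ^ 6) * n := by gcongr
    linarith
  have hk1 : (n : ℝ) ≤ (⌊(n : ℝ) / Real.log (Real.log n)⌋₊ + 1 : ℕ) * Real.log (Real.log n) := by
    rw [← div_le_iff₀ hl0]
    push_cast
    exact (Nat.lt_floor_add_one _).le
  have hk2 : ((⌊(n : ℝ) / Real.log (Real.log n)⌋₊ + 1 : ℕ) : ℝ) ≤ 2 / 10 ^ 6 * n := by
    have h1 := Nat.floor_le (by positivity : 0 ≤ (n : ℝ) / Real.log (Real.log n))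
    have h2 : (n : ℝ) / Real.log (Real.log n) ≤ n / 10 ^ 6 := by gcongr
    push_cast
    linarith
  have hc1 := choose_le_exp (numColours n) ⌈45 * eps n * n⌉₊
  have hc2 := choose_le_exp n (⌊(n : ℝ) / Real.log (Real.log n)⌋₊ + 1)
  generalize ⌊(n : ℝ) / Real.log (Real.log n)⌋₊ + 1 = k at *
  generalize ⌈45 * eps n * n⌉₊ = r at *
  have hexp : 44.5 * Real.log (Real.log n) * k ≤ (r : ℝ) / numColours n *
      (⌊(n : ℝ) * (Real.log n - Real.log (Real.log n))⌋₊ : ℝ) * k / n := by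
    rw [le_div_iff₀ hn0]
    calc _ = 44.5 * Real.log (Real.log n) * n * k := by ring
      _ ≤ _ := by gcongr
  calc _ ≤ Real.exp (numColours n / 1000 + 27 * r) * Real.exp (n / 1000 + 27 * k) *
        Real.exp (43 * eps n * Real.log n * k / 44 - (r : ℝ) / numColours n *
          (⌊(n : ℝ) * (Real.log n - Real.log (Real.log n))⌋₊ : ℝ) * k / n / 45) := by gcongr
    _ ≤ _ := by
        rw [← Real.exp_add, ← Real.exp_add, Real.exp_le_exp, mul_assoc 43, hεL]
        linarith

theorem tendsto_log_log_natCast :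
    Tendsto (fun n : ℕ => Real.log (Real.log n)) atTop atTop :=
  Real.tendsto_log_atTop.comp (Real.tendsto_log_atTop.comp tendsto_natCast_atTop_atTop)

theorem tendsto_eps : Tendsto eps atTop (nhds 0) := by
  have h := (Real.isLittleO_log_id_atTop.tendsto_div_nhds_zero).comp
    (Real.tendsto_log_atTop.comp tendsto_natCast_atTop_atTop)
  exact h

theorem floor_mul_log_sub_le {n : ℕ} (hn : 1 ≤ n) (hl : 0 ≤ Real.log (Real.log n)) :
    ⌊(n : ℝ) * (Real.log n - Real.log (Real.log n))⌋₊ ≤ n * (n - 1) := by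
  refine Nat.floor_le_of_le ?_
  have h1 : (0 : ℝ) < n := by exact_mod_cast hn
  have := Real.log_le_sub_one_of_pos h1
  push_cast [Nat.cast_sub hn]
  exact mul_le_mul_of_nonneg_left (by linarith) h1.le

/-- With `m₋ = ⌊n (log n - log log n)⌋`, a.a.s. in `D(n, m₋)`:
for every set `S` of `⌈45 ε n⌉` colours, at most `n / log log n` vertices have
in-degree at most `43 ε log n = 43 log log n` in the colours of `S`. -/
theorem aas_few_vertices_of_small_coloured_indegree :
    Tendsto
      (fun n : ℕ => prob (fun ω : SampleSpace n =>
        ∀ S : Set (Colour n), S.ncard = ⌈45 * eps n * n⌉₊ →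
          (({v : Fin n |
              (inDegreeInColours ω ⌊(n : ℝ) * (Real.log n - Real.log (Real.log n))⌋₊ S v : ℝ)
                ≤ 43 * eps n * Real.log n}.ncard : ℝ)
            ≤ (n : ℝ) / Real.log (Real.log n))))
      atTop (nhds 1) := by
  have hlim : Tendsto (fun n : ℕ => 1 - Real.exp (-((n : ℝ) / 1000))) atTop (nhds 1) := by
    have h : Tendsto (fun n : ℕ => (n : ℝ) / 1000) atTop atTop :=
      tendsto_natCast_atTop_atTop.atTop_div_const (by norm_num)
    simpa using (Real.tendsto_exp_neg_atTop_nhds_zero.comp h).const_sub 1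
  refine tendsto_of_tendsto_of_tendsto_of_le_of_le' hlim tendsto_const_nhds ?_ ?_
  · filter_upwards [eventually_ge_atTop (10 ^ 6), tendsto_log_log_natCast.eventually_ge_atTop
      (10 ^ 6), tendsto_eps.eventually_le_const (by norm_num : (0 : ℝ) < 1 / 10 ^ 6),
      (Real.tendsto_log_atTop.comp tendsto_natCast_atTop_atTop).eventually_gt_atTop 0]
      with n hn hl hε hL
    have hl0 : 0 ≤ Real.log (Real.log n) := le_trans (by norm_num) hl
    have hn1 : 1 ≤ n := le_trans (by norm_num) hn
    have hw : 0 < numColours n := hn1.trans (le_numColours (div_nonneg hl0 (le_of_lt hL)))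
    have : Nonempty (Colour n) := ⟨⟨0, hw⟩⟩
    exact (sub_le_sub_left (choose_mul_choose_mul_exp_le hn hl hL hε) 1).trans
      (one_sub_le_prob_few_small_coloured_indegree (le_trans (by norm_num) hn)
        (floor_mul_log_sub_le hn1 hl0) _ (by positivity))
  · refine Eventually.of_forall fun n => ?_
    classical
    unfold prob
    rw [Nat.card_eq_fintype_card]
    exact div_le_one_of_le₀ (by exact_mod_cast Fintype.card_subtype_le _) (Nat.cast_nonneg _)
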